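/- Let E be a non-vanishing extended multi-segment datum whose order satisfies (P′), and let j be a row label. Then the datum (∑_{i>j} sh_i^1)(E), obtained by shifting every row after the j-th one step to the right, is again a non-vanishing extended multi-segment datum whose order satisfies (P′). (Lemma 4.2(i) of the paper.) -/

import Mathlib

/-!
Common combinatorial setting for extended multi-segments (Moeglin-Atobe theory),
following Hazeltine-Liu-Lo, "On the intersection of local Arthur packets".
Rows of symbols are 0-indexed; row labels of labeled symbols are natural numbers.
-/

namespace LocalArthur

/-- A row `([A,B], l, eta)` of a symbol (an extended segment with the bound on `l` dropped). -/
structure Row where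
  A : ℚ
  B : ℚ
  l : ℚ
  eta : ℤ
deriving DecidableEq

/-- `a = A + B + 1`. -/
def Row.a (r : Row) : ℚ := r.A + r.B + 1

/-- `b = A - B + 1`. -/
def Row.b (r : Row) : ℚ := r.A - r.B + 1

/-- A rational number is an integer. -/
def IsInt (x : ℚ) : Prop := x.den = 1

instance (x : ℚ) : Decidable (IsInt x) := by unfold IsInt; infer_instance

/-- `(-1)^x` for an integer-valued rational `x` (junk value on non-integers). -/
def m1pow (x : ℚ) : ℤ := if x.num % 2 = 0 then 1 else -1

/-- Validity of a single row: `2A, 2B ∈ ℤ`, `A - B ∈ ℕ`, `l ∈ ℤ`, `eta = ±1`. -/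
def Row.IsES (r : Row) : Prop :=
  IsInt (2 * r.A) ∧ IsInt (2 * r.B) ∧ (∃ n : ℕ, r.A - r.B = (n : ℚ)) ∧
    IsInt r.l ∧ (r.eta = 1 ∨ r.eta = -1)

/-- The segment `[A,B]` of `r` is contained in that of `s`. -/
def Row.subseg (r s : Row) : Prop := s.B ≤ r.B ∧ r.A ≤ s.A

instance (r s : Row) : Decidable (r.subseg s) := by unfold Row.subseg; infer_instance

/-- A symbol: valid rows, `A_i + B_i ≥ 0`, all `A_i` congruent mod `ℤ`, and the
listed order admissible, i.e. condition (P). -/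
def IsSymbol (E : List Row) : Prop :=
  (∀ r ∈ E, r.IsES) ∧ (∀ r ∈ E, 0 ≤ r.A + r.B) ∧
    (∀ r ∈ E, ∀ s ∈ E, IsInt (r.A - s.A)) ∧
    E.Pairwise (fun r s => ¬ (s.A < r.A ∧ s.B < r.B))

/-- An extended multi-segment datum: a symbol with `0 ≤ l_i ≤ b_i / 2`. -/
def IsEMS (E : List Row) : Prop :=
  IsSymbol E ∧ ∀ r ∈ E, 0 ≤ r.l ∧ r.l ≤ r.b / 2

/-- The listed order satisfies (P'). -/
def Pprime (E : List Row) : Prop := E.Pairwise (fun r s => r.B ≤ s.B)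

/-- Equivalence of extended segments. -/
def Row.Equiv (r s : Row) : Prop :=
  r.A = s.A ∧ r.B = s.B ∧ r.l = s.l ∧ (r.eta = s.eta ∨ r.l = r.b / 2)

/-- Rowwise equivalence of symbols. -/
def SymEquiv (E F : List Row) : Prop := List.Forall₂ Row.Equiv E F

/-- Shift of one row: `[A,B] ↦ [A+d, B+d]`. -/
def Row.sh (r : Row) (d : ℤ) : Row := { r with A := r.A + d, B := r.B + d }

/-- Add on one row: `([A,B],l) ↦ ([A+d, B-d], l+d)`. -/
def Row.addOp (r : Row) (d : ℤ) : Row :=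
  { r with A := r.A + d, B := r.B - d, l := r.l + d }

/-- `sh^d` applied to every row. -/
def shAll (d : ℤ) (E : List Row) : List Row := E.map fun r => r.sh d

/-- The updated pair of rows in a row exchange of rows `r = row k` and `s = row k+1`
(assuming one of the segments contains the other); the first component is the new row
at position `k` (the updated `s`) and the second the new row at position `k+1`
(the updated `r`). -/
def rexPair (r s : Row) : Row × Row :=
  if r.subseg s then
    -- Case `[A_k,B_k] ⊆ [A_{k+1},B_{k+1}]`
    (if m1pow (r.A - r.B) * r.eta * s.eta = 1 then
        if s.b - 2 * s.l < 2 * (r.b - 2 * r.l) then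
          (⟨s.A, s.B, s.b - (s.l + (r.b - 2 * r.l)), m1pow (r.A - r.B) * s.eta⟩ : Row)
        else ⟨s.A, s.B, s.l + (r.b - 2 * r.l), m1pow (r.A - r.B + 1) * s.eta⟩
      else ⟨s.A, s.B, s.l - (r.b - 2 * r.l), m1pow (r.A - r.B + 1) * s.eta⟩,
     ⟨r.A, r.B, r.l, m1pow (s.A - s.B) * r.eta⟩)
  else
    -- Case `[A_{k+1},B_{k+1}] ⊊ [A_k,B_k]`
    (⟨s.A, s.B, s.l, m1pow (r.A - r.B) * s.eta⟩,
     if m1pow (r.A - r.B) * r.eta * s.eta = 1 then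
        if r.b - 2 * r.l < 2 * (s.b - 2 * s.l) then
          (⟨r.A, r.B, r.b - (r.l + (s.b - 2 * s.l)), m1pow (s.A - s.B) * r.eta⟩ : Row)
        else ⟨r.A, r.B, r.l + (s.b - 2 * s.l), m1pow (s.A - s.B + 1) * r.eta⟩
      else ⟨r.A, r.B, r.l - (s.b - 2 * s.l), m1pow (s.A - s.B + 1) * r.eta⟩)

/-- Row exchange `R_k` at positions `k, k+1` (0-indexed). -/
def rex (k : ℕ) (E : List Row) : List Row :=
  match E[k]?, E[k+1]? with
  | some r, some s =>
      if r.subseg s ∨ s.subseg r then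
        E.take k ++ (rexPair r s).1 :: (rexPair r s).2 :: E.drop (k + 2)
      else E
  | _, _ => E

/-- One row exchange step. -/
def ReorderStep (E F : List Row) : Prop := ∃ k, F = rex k E

/-- Admissible reorderings: finite sequences of row exchanges. -/
def Reorder : List Row → List Row → Prop := Relation.ReflTransGen ReorderStep

/-- Coincidence up to row exchanges (in either direction) and rowwise equivalence. -/
def UpToRex (E F : List Row) : Prop :=
  ∃ G, Relation.ReflTransGen (fun X Y => ReorderStep X Y ∨ ReorderStep Y X) E G ∧
    SymEquiv G F

/-- `α_i = ∑_{j<i} (A_j + B_j + 1)`. -/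
def alphaAt (E : List Row) (i : ℕ) : ℚ := ((E.take i).map Row.a).sum

/-- `β_i = ∑_{j>i} (A_j - B_j + 1)`. -/
def betaAt (E : List Row) (i : ℕ) : ℚ := ((E.drop (i + 1)).map Row.b).sum

/-- `γ_i = ∑_{j>i} (A_j + B_j + 1)`. -/
def gammaAt (E : List Row) (i : ℕ) : ℚ := ((E.drop (i + 1)).map Row.a).sum

/-- Condition (∗) of the non-vanishing criterion. -/
def StarCond (E : List Row) : Prop :=
  ∀ i : ℕ, ∀ r : Row, E[i]? = some r →
    (IsInt r.B → 0 ≤ r.B + r.l) ∧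
    (¬ IsInt r.B → r.eta = - m1pow (alphaAt E i) → (1 / 2 : ℚ) ≤ r.B + r.l) ∧
    (¬ IsInt r.B → r.eta = m1pow (alphaAt E i) → -(1 / 2 : ℚ) ≤ r.B + r.l)

/-- Xu's non-vanishing conditions at an adjacent pair of rows `(r, s) = (row k, row k+1)`. -/
def XuPair (r s : Row) : Prop :=
  ((r.A ≤ s.A ∧ r.B ≤ s.B) →
    (m1pow (r.A - r.B) * r.eta * s.eta = 1 →
        r.B + r.l ≤ s.B + s.l ∧ r.A - r.l ≤ s.A - s.l) ∧
    (m1pow (r.A - r.B) * r.eta * s.eta = -1 → r.A - r.l < s.B + s.l)) ∧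
  ((r.subseg s ∧ ¬ s.subseg r) →
    (m1pow (r.A - r.B) * r.eta * s.eta = 1 → 0 ≤ s.l - r.l ∧ s.l - r.l ≤ s.b - r.b) ∧
    (m1pow (r.A - r.B) * r.eta * s.eta = -1 → r.b ≤ r.l + s.l)) ∧
  ((s.subseg r ∧ ¬ r.subseg s) →
    (m1pow (r.A - r.B) * r.eta * s.eta = 1 → 0 ≤ r.l - s.l ∧ r.l - s.l ≤ r.b - s.b) ∧
    (m1pow (r.A - r.B) * r.eta * s.eta = -1 → s.b ≤ r.l + s.l))

/-- Xu's non-vanishing conditions at every adjacent pair of rows. -/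
def XuAll (E : List Row) : Prop := E.Chain' XuPair

/-- The non-vanishing criterion for an extended multi-segment datum. -/
def NonVanishing (E : List Row) : Prop :=
  StarCond E ∧
    ∀ d : ℕ, (∀ r ∈ E, 0 ≤ r.B + (d : ℚ)) →
      ∀ F, Reorder (shAll d E) F → XuAll F

/-- Applicability of a union-intersection at an adjacent pair of rows. -/
def uiApplicablePair (r s : Row) : Prop :=
  r.A < s.A ∧ r.B < s.B ∧
    ((m1pow (r.A - r.B) * r.eta * s.eta = 1 ∧
        (s.A - s.l = r.A - r.l ∨ s.B + s.l = r.B + r.l)) ∨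
      (m1pow (r.A - r.B) * r.eta * s.eta = -1 ∧ s.B + s.l = r.A - r.l + 1))

instance (r s : Row) : Decidable (uiApplicablePair r s) := by
  unfold uiApplicablePair; infer_instance

/-- Type 3' of a union-intersection at an adjacent pair. -/
def uiT3 (r s : Row) : Prop :=
  r.l = 0 ∧ s.l = 0 ∧ m1pow (r.A - r.B) * r.eta * s.eta = -1

instance (r s : Row) : Decidable (uiT3 r s) := by unfold uiT3; infer_instance

/-- The pair of rows produced by a union-intersection at an adjacent applicable pair. -/
def uiPair (r s : Row) : Row × Row :=
  if m1pow (r.A - r.B) * r.eta * s.eta = 1 then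
    if s.A - s.l = r.A - r.l then
      -- Case 1
      ((⟨s.A, r.B, r.l, r.eta⟩ : Row),
       (⟨r.A, s.B, s.l - (s.A - r.A), m1pow (s.A - r.A) * s.eta⟩ : Row))
    else
      -- Case 2
      if s.A - r.A ≤ r.b - 2 * r.l then
        (⟨s.A, r.B, r.l + (s.A - r.A), r.eta⟩,
         ⟨r.A, s.B, s.l, m1pow (s.A - r.A) * s.eta⟩)
      else
        (⟨s.A, r.B, r.b - r.l, - r.eta⟩,
         ⟨r.A, s.B, s.l, m1pow (s.A - r.A) * s.eta⟩)
  else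
    -- Case 3
    if s.l ≤ r.l then
      (⟨s.A, r.B, r.l, r.eta⟩, ⟨r.A, s.B, s.l, m1pow (s.A - r.A) * s.eta⟩)
    else
      (⟨s.A, r.B, r.l, r.eta⟩, ⟨r.A, s.B, r.l, m1pow (s.A - r.A + 1) * s.eta⟩)

/-- Union-intersection at positions `k, k+1` (deleting the second new row in type 3'). -/
def uiAt (k : ℕ) (E : List Row) : List Row :=
  match E[k]?, E[k+1]? with
  | some r, some s =>
      if uiApplicablePair r s then
        if uiT3 r s then
          E.take k ++ (uiPair r s).1 :: E.drop (k + 2)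
        else
          E.take k ++ (uiPair r s).1 :: (uiPair r s).2 :: E.drop (k + 2)
      else E
  | _, _ => E

/-- Minimality: no union-intersection is applicable. -/
def MinimalP (E : List Row) : Prop :=
  ∀ F, Reorder E F → ∀ k r s, F[k]? = some r → F[k+1]? = some s →
    ¬ uiApplicablePair r s

/-- The image of a row under Atobe's dual. -/
def dualRow (E : List Row) (i : ℕ) (r : Row) : Row :=
  let α := alphaAt E i
  let β := betaAt E i
  let η₀ : ℤ := if ¬ IsInt r.B ∧ r.l = r.b / 2 then - m1pow α else r.eta
  if IsInt r.B then
    ⟨r.A, -r.B, r.l + r.B, m1pow (α + β) * η₀⟩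
  else
    ⟨r.A, -r.B, r.l + r.B + ((m1pow α * η₀ : ℤ) : ℚ) / 2, - (m1pow (α + β) * η₀)⟩

/-- Atobe's dual of a symbol whose order satisfies (P'). -/
def dual (E : List Row) : List Row :=
  (E.mapIdx fun i r => dualRow E i r).reverse

/-- Applicability of the partial dual `dual_k^+` at position `k` (0-indexed). -/
def DualPlusApplicable (E : List Row) (k : ℕ) : Prop :=
  ∃ r, E[k]? = some r ∧ r.B = 1 / 2 ∧ r.l = 0 ∧ r.eta = - m1pow (alphaAt E k) ∧
    ∀ i, i < k → ∀ s, E[i]? = some s → s.B < 1 / 2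

/-- The partial dual `dual_k^+` at position `k`. -/
def dualPlus (k : ℕ) (E : List Row) : List Row :=
  match E[k]? with
  | some rk =>
      (dual ((dual E).set (E.length - 1 - k)
          ⟨rk.A, 1 / 2, 0, - m1pow (gammaAt E k)⟩)).take k ++
        (⟨rk.A, -(1 / 2), 0, - rk.eta⟩ : Row) :: E.drop (k + 1)
  | none => E

/-- Applicability of the partial dual `dual_k^-`. -/
def DualMinusApplicable (E : List Row) (k : ℕ) : Prop :=
  DualPlusApplicable (dual E) (E.length - 1 - k)

/-- The partial dual `dual_k^-`. -/
def dualMinus (k : ℕ) (E : List Row) : List Row :=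
  dual (dualPlus (E.length - 1 - k) (dual E))

/-- Maximality: `E` is not, up to row exchanges, the result of a union-intersection
applied to a non-vanishing extended multi-segment datum. -/
def Maximal (E : List Row) : Prop :=
  ¬ ∃ (E'' F : List Row) (k : ℕ) (r s : Row), IsEMS E'' ∧ NonVanishing E'' ∧
      Reorder E'' F ∧ F[k]? = some r ∧ F[k+1]? = some s ∧ uiApplicablePair r s ∧
      UpToRex (uiAt k F) E

/-- Absolute maximality. -/
def AbsolutelyMaximal (E : List Row) : Prop := Maximal E ∧ MinimalP (dual E)

/-- The sign `(-1)^{⌊b/2⌋ + l} * eta^b` of a row. -/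
def rowSign (r : Row) : ℤ :=
  (if (⌊r.b / 2⌋ + ⌊r.l⌋) % 2 = 0 then (1 : ℤ) else -1) * r.eta ^ (⌊r.b⌋.toNat)

/-- The sign product of a symbol. -/
def signProd (E : List Row) : ℤ := (E.map rowSign).prod

/-! ### Labeled symbols: rows carry labels that travel with them under reorderings. -/

/-- A labeled row. -/
abbrev LRow := ℕ × Row

/-- The underlying list of rows of a labeled symbol. -/
def rows (L : List LRow) : List Row := L.map Prod.snd

/-- `sh_i^d`, acting on the row labeled `i`. -/
def shL (i : ℕ) (d : ℤ) (L : List LRow) : List LRow :=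
  L.map fun p => if p.1 = i then (p.1, p.2.sh d) else p

/-- `add_i^d`, acting on the row labeled `i`. -/
def addL (i : ℕ) (d : ℤ) (L : List LRow) : List LRow :=
  L.map fun p => if p.1 = i then (p.1, p.2.addOp d) else p

/-- `sh^d` on a labeled symbol. -/
def shAllL (d : ℤ) (L : List LRow) : List LRow := L.map fun p => (p.1, p.2.sh d)

/-- Row exchange at positions `k, k+1` on a labeled symbol. -/
def rexL (k : ℕ) (L : List LRow) : List LRow :=
  match L[k]?, L[k+1]? with
  | some (a, r), some (c, s) =>
      if r.subseg s ∨ s.subseg r then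
        L.take k ++ (c, (rexPair r s).1) :: (a, (rexPair r s).2) :: L.drop (k + 2)
      else L
  | _, _ => L

/-- One row exchange step on labeled symbols. -/
def ReorderStepL (L M : List LRow) : Prop := ∃ k, M = rexL k L

/-- Admissible reorderings of labeled symbols. -/
def ReorderL : List LRow → List LRow → Prop := Relation.ReflTransGen ReorderStepL

/-- Labelwise equivalence of labeled symbols. -/
def LSymEquiv (L M : List LRow) : Prop :=
  List.Forall₂ (fun p q => p.1 = q.1 ∧ Row.Equiv p.2 q.2) L M

/-- `M` coincides with `L` up to row exchanges and rowwise equivalence (labels forgotten). -/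
def CoincidesUpToRex (L M : List LRow) : Prop :=
  ∃ L', Relation.ReflTransGen (fun X Y => ReorderStepL X Y ∨ ReorderStepL Y X) L L' ∧
    SymEquiv (rows L') (rows M)

/-- Union-intersection at positions `k, k+1` on a labeled symbol. -/
def uiAtL (k : ℕ) (L : List LRow) : List LRow :=
  match L[k]?, L[k+1]? with
  | some (a, r), some (c, s) =>
      if uiApplicablePair r s then
        if uiT3 r s then
          L.take k ++ (a, (uiPair r s).1) :: L.drop (k + 2)
        else
          L.take k ++ (a, (uiPair r s).1) :: (c, (uiPair r s).2) :: L.drop (k + 2)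
      else L
  | _, _ => L

/-- The relation `M = ui_{i,j}(L)`, with a constraint `P` on the adjacent pair used:
some admissible reordering `L'` of `L` puts the row labeled `i` immediately before the
row labeled `j`, `ui` is applicable there, and `M` is obtained from the result by row
exchanges restoring the original relative order of the (surviving) labels. -/
def UIrelWith (P : Row → Row → Prop) (L : List LRow) (i j : ℕ) (M : List LRow) : Prop :=
  ∃ (L' : List LRow) (k : ℕ) (r s : Row),
    ReorderL L L' ∧ L'[k]? = some (i, r) ∧ L'[k+1]? = some (j, s) ∧
    uiApplicablePair r s ∧ P r s ∧
    ReorderL (uiAtL k L') M ∧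
    M.map Prod.fst =
      (L.map Prod.fst).filter fun x => decide (x ∈ (uiAtL k L').map Prod.fst)

/-- The relation `M = ui_{i,j}(L)`. -/
def UIrel (L : List LRow) (i j : ℕ) (M : List LRow) : Prop :=
  UIrelWith (fun _ _ => True) L i j M

/-- Atobe's dual of a labeled symbol. -/
def dualL (L : List LRow) : List LRow :=
  (L.mapIdx fun i p => (p.1, dualRow (rows L) i p.2)).reverse

/-- The partial dual `dual^+` at position `k` on a labeled symbol. -/
def dualPlusL (k : ℕ) (L : List LRow) : List LRow :=
  match L[k]? with
  | some (lab, rk) =>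
      (dualL ((dualL L).set (L.length - 1 - k)
          (lab, ⟨rk.A, 1 / 2, 0, - m1pow (gammaAt (rows L) k)⟩))).take k ++
        (lab, (⟨rk.A, -(1 / 2), 0, - rk.eta⟩ : Row)) :: L.drop (k + 1)
  | none => L

/-- Position of the row labeled `i`. -/
def posOf (L : List LRow) (i : ℕ) : ℕ := L.findIdx fun p => p.1 == i

/-- The partial dual `dual_i^+`, acting at the row labeled `i`. -/
def dualPlusLab (i : ℕ) (L : List LRow) : List LRow := dualPlusL (posOf L i) L

/-- Applicability of `dual_i^+` on a labeled symbol. -/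
def DualPlusApplicableLab (i : ℕ) (L : List LRow) : Prop :=
  i ∈ L.map Prod.fst ∧ DualPlusApplicable (rows L) (posOf L i)

/-- The partial dual `dual_i^-` on a labeled symbol. -/
def dualMinusLab (i : ℕ) (L : List LRow) : List LRow := dualL (dualPlusLab i (dualL L))

/-- Applicability of `dual_i^-` on a labeled symbol. -/
def DualMinusApplicableLab (i : ℕ) (L : List LRow) : Prop :=
  DualPlusApplicableLab i (dualL L)

/-- One basic operator step: a row exchange, a union-intersection, a composition
`dual ∘ ui_{i,j} ∘ dual`, or an inverse of one of these. -/
def BasicStep (L M : List LRow) : Prop :=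
  (∃ k, M = rexL k L) ∨ (∃ k, L = rexL k M) ∨
  (∃ i j, UIrel L i j M) ∨ (∃ i j, UIrel M i j L) ∨
  (∃ i j N, UIrel (dualL L) i j N ∧ M = dualL N) ∨
  (∃ i j N, UIrel (dualL M) i j N ∧ L = dualL N)

/-- Finite sequences of basic operators. -/
def Basic : List LRow → List LRow → Prop := Relation.ReflTransGen BasicStep

/-- Shift every row after position `j` one step to the right. -/
def shAfter (j : ℕ) (E : List Row) : List Row :=
  E.mapIdx fun i r => if j < i then r.sh 1 else r

/-- Shift every row with `B_i ≥ B` one step to the left. -/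
def shiftGE (B : ℚ) (E : List Row) : List Row :=
  E.map fun r => if B ≤ r.B then r.sh (-1) else r

/-- Shift every row with `B_i ≥ 1/2` one step to the left, deleting the rows of the
form `([1/2,1/2], 0, η)`. -/
def shiftHalfDel (E : List Row) : List Row :=
  (E.filter fun r => !decide (r.A = 1 / 2 ∧ r.B = 1 / 2 ∧ r.l = 0)).map
    fun r => if (1 / 2 : ℚ) ≤ r.B then r.sh (-1) else r

/-- The rows `([A-r, -(A-r)-1], ⌊A⌋-r, 1)` for `r = 0, …, ⌊A⌋`. -/
def prefixRows (A : ℚ) : List Row :=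
  (List.range (⌊A⌋.toNat + 1)).map fun r =>
    ⟨A - r, -(A - r) - 1, (⌊A⌋ : ℚ) - r, 1⟩

/-! ### Parity and integrality under shifts -/

theorem isInt_iff {x : ℚ} : IsInt x ↔ ∃ n : ℤ, x = n :=
  ⟨fun h => ⟨x.num, (Rat.coe_int_num_of_den_eq_one h).symm⟩, by rintro ⟨n, rfl⟩; exact rfl⟩

theorem isInt_add_intCast (x : ℚ) (n : ℤ) : IsInt (x + n) ↔ IsInt x := by
  unfold IsInt
  rw [Rat.add_intCast_den]

theorem m1pow_add_two_mul (x : ℚ) (n : ℤ) : m1pow (x + 2 * n) = m1pow x := by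
  have hden : (x + ((2 * n : ℤ) : ℚ)).den = x.den := Rat.add_intCast_den x (2 * n)
  have hnum : (x + ((2 * n : ℤ) : ℚ)).num = x.num + 2 * n * x.den := by
    have hx : (x.den : ℚ) ≠ 0 := by exact_mod_cast x.den_nz
    have h₁ := Rat.mul_den_eq_num (x + ((2 * n : ℤ) : ℚ))
    rw [hden, add_mul, Rat.mul_den_eq_num] at h₁
    exact_mod_cast h₁.symm
  push_cast at hnum
  unfold m1pow
  rw [hnum, mul_assoc, Int.add_mul_emod_self_left]

@[simp] theorem Row.sh_A (r : Row) (d : ℤ) : (r.sh d).A = r.A + d := rfl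

@[simp] theorem Row.sh_B (r : Row) (d : ℤ) : (r.sh d).B = r.B + d := rfl

@[simp] theorem Row.sh_l (r : Row) (d : ℤ) : (r.sh d).l = r.l := rfl

@[simp] theorem Row.sh_eta (r : Row) (d : ℤ) : (r.sh d).eta = r.eta := rfl

@[simp] theorem Row.sh_b (r : Row) (d : ℤ) : (r.sh d).b = r.b := by
  simp [Row.b]

theorem Row.sh_sh (r : Row) (c d : ℤ) : (r.sh c).sh d = (r.sh d).sh c := by
  simp [Row.sh, add_right_comm]

theorem Row.sh_zero (r : Row) : r.sh 0 = r := by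
  simp [Row.sh]

theorem Row.IsES.sh {r : Row} (h : r.IsES) (d : ℤ) : (r.sh d).IsES := by
  obtain ⟨hA, hB, hn, hl, he⟩ := h
  refine ⟨?_, ?_, by simpa using hn, hl, he⟩
  · have : 2 * (r.sh d).A = 2 * r.A + ((2 * d : ℤ) : ℚ) := by simp; ring
    rwa [this, isInt_add_intCast]
  · have : 2 * (r.sh d).B = 2 * r.B + ((2 * d : ℤ) : ℚ) := by simp; ring
    rwa [this, isInt_add_intCast]

/-! ### Row exchanges of partially shifted symbols

A row carries a flag telling whether it is to be shifted one step to the right. -/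

/-- The row of a flagged row, shifted one step to the right if the flag is set. -/
def flagShift (p : Bool × Row) : Row := p.2.sh (if p.1 then 1 else 0)

/-- The `A` are congruent mod `ℤ`, and an unflagged row starts no later than a flagged one. -/
def Compat (p q : Bool × Row) : Prop :=
  IsInt (p.2.A - q.2.A) ∧ (p.1 = false → q.1 = true → p.2.B ≤ q.2.B)

/-- Any two flagged rows of the list are compatible. -/
def CompatAll (L : List (Bool × Row)) : Prop := ∀ p ∈ L, ∀ q ∈ L, Compat p q

theorem rexPair_sh {r s : Row} {c d : ℤ} (h : (r.sh c).subseg (s.sh d) ↔ r.subseg s) :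
    rexPair (r.sh c) (s.sh d) = ((rexPair r s).1.sh d, (rexPair r s).2.sh c) := by
  unfold rexPair
  simp only [h, Row.sh_A, Row.sh_B, Row.sh_l, Row.sh_eta, Row.sh_b, add_sub_add_right_eq_sub]
  split_ifs <;> rfl

theorem rexPair_fst_A (r s : Row) : (rexPair r s).1.A = s.A := by
  unfold rexPair; split_ifs <;> rfl

theorem rexPair_fst_B (r s : Row) : (rexPair r s).1.B = s.B := by
  unfold rexPair; split_ifs <;> rfl

theorem rexPair_snd_A (r s : Row) : (rexPair r s).2.A = r.A := by
  unfold rexPair; split_ifs <;> rfl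

theorem rexPair_snd_B (r s : Row) : (rexPair r s).2.B = r.B := by
  unfold rexPair; split_ifs <;> rfl

/-- Containment of the shifted segments implies containment of the original ones, in the
same direction. -/
theorem subseg_flagShift {p q : Bool × Row} (hpq : Compat p q) (hqp : Compat q p)
    (h : (flagShift p).subseg (flagShift q) ∨ (flagShift q).subseg (flagShift p)) :
    (p.2.subseg q.2 ∨ q.2.subseg p.2) ∧
      ((flagShift p).subseg (flagShift q) ↔ p.2.subseg q.2) := by
  obtain ⟨x, r⟩ := p
  obtain ⟨y, s⟩ := q
  have h₁ := hpq.2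
  have h₂ := hqp.2
  cases x <;> cases y <;> simp [flagShift, Row.subseg] at h h₁ h₂ ⊢ <;> grind

/-- Xu's conditions at a pair survive the shift of the flagged rows. -/
theorem XuPair.flagShift {p q : Bool × Row} (hpq : Compat p q) (hqp : Compat q p)
    (h : XuPair p.2 q.2) : XuPair (flagShift p) (flagShift q) := by
  obtain ⟨x, r⟩ := p
  obtain ⟨y, s⟩ := q
  have h₁ := hpq.2
  have h₂ := hqp.2
  obtain ⟨n, hn⟩ := isInt_iff.1 hpq.1
  have hint : r.A < s.A + 1 → r.A ≤ s.A := fun hlt => by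
    have hn₁ : (n : ℚ) < 1 := by simp only at hn; linarith
    have hn₀ : (n : ℚ) ≤ 0 := by exact_mod_cast Int.lt_add_one_iff.1 (by exact_mod_cast hn₁)
    simp only at hn
    linarith
  simp only [XuPair, LocalArthur.flagShift, Row.subseg, Row.sh_A, Row.sh_B, Row.sh_l,
    Row.sh_eta, Row.sh_b, add_sub_add_right_eq_sub] at h h₁ h₂ ⊢
  generalize m1pow (r.A - r.B) * r.eta * s.eta = e at h ⊢
  simp only [Row.b] at h ⊢
  cases x <;> cases y <;> simp at h h₁ h₂ ⊢ <;> grind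

theorem ReorderStep.exists_flagShift {L : List (Bool × Row)} (hL : CompatAll L) {F : List Row}
    (h : ReorderStep (L.map flagShift) F) :
    ∃ M, CompatAll M ∧ F = M.map flagShift ∧
      ReorderStep (L.map Prod.snd) (M.map Prod.snd) := by
  obtain ⟨k, rfl⟩ := h
  have stay : rex k (L.map flagShift) = L.map flagShift → ∃ M, CompatAll M ∧
      rex k (L.map flagShift) = M.map flagShift ∧
        ReorderStep (L.map Prod.snd) (M.map Prod.snd) := fun h =>
    ⟨L, hL, h, (L.map Prod.snd).length, by simp [rex]⟩
  rcases hp : L[k]? with _ | p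
  · exact stay (by simp [rex, hp])
  rcases hq : L[k + 1]? with _ | q
  · exact stay (by simp [rex, hp, hq])
  by_cases hc : (flagShift p).subseg (flagShift q) ∨ (flagShift q).subseg (flagShift p)
  swap
  · exact stay (by simp [rex, hp, hq, hc])
  have hpL := List.mem_of_getElem? hp
  have hqL := List.mem_of_getElem? hq
  obtain ⟨hc₀, hiff⟩ := subseg_flagShift (hL p hpL q hqL) (hL q hqL p hpL) hc
  have hex : rexPair (flagShift p) (flagShift q) =
      (flagShift (q.1, (rexPair p.2 q.2).1), flagShift (p.1, (rexPair p.2 q.2).2)) :=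
    rexPair_sh hiff
  refine ⟨L.take k ++ (q.1, (rexPair p.2 q.2).1) :: (p.1, (rexPair p.2 q.2).2) :: L.drop (k + 2),
    ?_, ?_, k, ?_⟩
  · have old : ∀ m ∈ L.take k ++ (q.1, (rexPair p.2 q.2).1) ::
        (p.1, (rexPair p.2 q.2).2) :: L.drop (k + 2),
        ∃ m₀ ∈ L, m.1 = m₀.1 ∧ m.2.A = m₀.2.A ∧ m.2.B = m₀.2.B := by
      intro m hm
      simp only [List.mem_append, List.mem_cons] at hm
      rcases hm with hm | rfl | rfl | hm
      · exact ⟨m, List.mem_of_mem_take hm, rfl, rfl, rfl⟩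
      · exact ⟨q, hqL, rfl, rexPair_fst_A _ _, rexPair_fst_B _ _⟩
      · exact ⟨p, hpL, rfl, rexPair_snd_A _ _, rexPair_snd_B _ _⟩
      · exact ⟨m, List.mem_of_mem_drop hm, rfl, rfl, rfl⟩
    intro m hm m' hm'
    obtain ⟨n, hn, e₁, e₂, e₃⟩ := old m hm
    obtain ⟨n', hn', e₁', e₂', e₃'⟩ := old m' hm'
    have := hL n hn n' hn'
    unfold Compat at this ⊢
    rwa [e₁, e₂, e₃, e₁', e₂', e₃']
  · simp [rex, hp, hq, hc, hex]
  · simp [rex, hp, hq, hc₀]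

theorem Reorder.exists_flagShift {L : List (Bool × Row)} (hL : CompatAll L) {F : List Row}
    (h : Reorder (L.map flagShift) F) :
    ∃ M, CompatAll M ∧ F = M.map flagShift ∧ Reorder (L.map Prod.snd) (M.map Prod.snd) := by
  induction h with
  | refl => exact ⟨L, hL, rfl, .refl⟩
  | tail _ hstep ih =>
    obtain ⟨M, hM, rfl, hLM⟩ := ih
    obtain ⟨N, hN, rfl, hMN⟩ := hstep.exists_flagShift hM
    exact ⟨N, hN, rfl, hLM.tail hMN⟩

theorem XuAll.map_flagShift {M : List (Bool × Row)} (hM : CompatAll M)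
    (h : XuAll (M.map Prod.snd)) : XuAll (M.map flagShift) := by
  refine (List.isChain_map flagShift).2 ?_
  exact ((List.isChain_map Prod.snd).1 h).imp_of_mem_imp fun p q hp hq hpq =>
    XuPair.flagShift (hM p hp q hq) (hM q hq p hp) hpq

/-! ### The shift of the rows after a given one -/

theorem getElem?_shAfter (j : ℕ) (E : List Row) (i : ℕ) :
    (shAfter j E)[i]? = E[i]?.map fun r => r.sh (if j < i then 1 else 0) := by
  unfold shAfter
  rw [List.getElem?_mapIdx]
  split_ifs <;> simp [Row.sh_zero]

theorem mem_shAfter {j : ℕ} {E : List Row} {r : Row} (h : r ∈ shAfter j E) :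
    ∃ s ∈ E, ∃ d : ℤ, 0 ≤ d ∧ r = s.sh d := by
  obtain ⟨i, hi⟩ := List.mem_iff_getElem?.1 h
  rw [getElem?_shAfter, Option.map_eq_some_iff] at hi
  obtain ⟨s, hs, rfl⟩ := hi
  exact ⟨s, List.mem_of_getElem? hs, _, by split_ifs <;> simp, rfl⟩

theorem Pprime.le_of_lt {E : List Row} (hP : Pprime E) {i k : ℕ} {r s : Row} (hik : i < k)
    (hr : E[i]? = some r) (hs : E[k]? = some s) : r.B ≤ s.B := by
  obtain ⟨hi, rfl⟩ := List.getElem?_eq_some_iff.1 hr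
  obtain ⟨hk, rfl⟩ := List.getElem?_eq_some_iff.1 hs
  exact List.pairwise_iff_getElem.1 hP i k hi hk hik

theorem Pprime.shAfter {E : List Row} (hP : Pprime E) (j : ℕ) : Pprime (shAfter j E) := by
  refine List.pairwise_iff_getElem.2 fun i k hi hk hik => ?_
  have hi' := getElem?_shAfter j E i
  have hk' := getElem?_shAfter j E k
  rw [List.getElem?_eq_getElem hi, eq_comm, Option.map_eq_some_iff] at hi'
  rw [List.getElem?_eq_getElem hk, eq_comm, Option.map_eq_some_iff] at hk'
  obtain ⟨r, hr, hr'⟩ := hi'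
  obtain ⟨s, hs, hs'⟩ := hk'
  have := hP.le_of_lt hik hr hs
  rw [← hr', ← hs', Row.sh_B, Row.sh_B]
  split_ifs with h₁ h₂ h₂
  · simpa using this
  · omega
  · push_cast; linarith
  · simpa using this

theorem IsEMS.shAfter {E : List Row} (hE : IsEMS E) (hP : Pprime E) (j : ℕ) :
    IsEMS (shAfter j E) := by
  obtain ⟨⟨hES, hAB, hint, -⟩, hl⟩ := hE
  refine ⟨⟨fun r hr => ?_, fun r hr => ?_, fun r hr s hs => ?_, ?_⟩, fun r hr => ?_⟩
  · obtain ⟨r, hrE, d, -, rfl⟩ := mem_shAfter hr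
    exact (hES r hrE).sh d
  · obtain ⟨r, hrE, d, hd, rfl⟩ := mem_shAfter hr
    have : (0 : ℚ) ≤ d := by exact_mod_cast hd
    have := hAB r hrE
    simp only [Row.sh_A, Row.sh_B]
    linarith
  · obtain ⟨r, hrE, c, -, rfl⟩ := mem_shAfter hr
    obtain ⟨s, hsE, d, -, rfl⟩ := mem_shAfter hs
    have : (r.sh c).A - (s.sh d).A = r.A - s.A + ((c - d : ℤ) : ℚ) := by simp; ring
    rw [this, isInt_add_intCast]
    exact hint r hrE s hsE
  · exact (hP.shAfter j).imp fun h h' => absurd h'.2 (not_lt.2 h)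
  · obtain ⟨r, hrE, d, -, rfl⟩ := mem_shAfter hr
    simpa using hl r hrE

theorem exists_alphaAt_shAfter (j : ℕ) (E : List Row) (i : ℕ) :
    ∃ n : ℤ, alphaAt (shAfter j E) i = alphaAt E i + 2 * n := by
  induction i with
  | zero => exact ⟨0, by simp [alphaAt]⟩
  | succ i ih =>
    obtain ⟨n, hn⟩ := ih
    unfold alphaAt at hn ⊢
    rw [List.take_add_one, List.take_add_one, getElem?_shAfter, List.map_append, List.map_append,
      List.sum_append, List.sum_append, hn]
    rcases E[i]? with _ | r
    · exact ⟨n, by simp⟩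
    · refine ⟨n + if j < i then 1 else 0, ?_⟩
      simp [Row.a]
      ring

theorem StarCond.shAfter {E : List Row} (h : StarCond E) (j : ℕ) : StarCond (shAfter j E) := by
  intro i r hr
  rw [getElem?_shAfter, Option.map_eq_some_iff] at hr
  obtain ⟨r, hr, rfl⟩ := hr
  obtain ⟨n, hn⟩ := exists_alphaAt_shAfter j E i
  obtain ⟨h₁, h₂, h₃⟩ := h i r hr
  rw [hn, m1pow_add_two_mul, Row.sh_B, isInt_add_intCast, Row.sh_l, Row.sh_eta]
  have hd : (0 : ℚ) ≤ ((if j < i then 1 else 0 : ℤ) : ℚ) := by split_ifs <;> simp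
  exact ⟨fun hB => by linarith [h₁ hB], fun hB he => by linarith [h₂ hB he],
    fun hB he => by linarith [h₃ hB he]⟩

/-- The rows of `sh^d(E)`, flagged when they come after the `j`-th one. -/
def flagAfter (j : ℕ) (d : ℤ) (E : List Row) : List (Bool × Row) :=
  E.mapIdx fun i r => (decide (j < i), r.sh d)

theorem map_flagShift_flagAfter (j : ℕ) (d : ℤ) (E : List Row) :
    (flagAfter j d E).map flagShift = shAll d (shAfter j E) := by
  refine List.ext_getElem? fun i => ?_
  simp only [flagAfter, shAll, List.getElem?_map, List.getElem?_mapIdx, getElem?_shAfter,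
    Option.map_map]
  congr 1
  funext r
  simp only [Function.comp, flagShift, decide_eq_true_eq]
  exact Row.sh_sh _ _ _

theorem map_snd_flagAfter (j : ℕ) (d : ℤ) (E : List Row) :
    (flagAfter j d E).map Prod.snd = shAll d E := by
  refine List.ext_getElem? fun i => ?_
  simp [flagAfter, shAll, Function.comp_def]

theorem compatAll_flagAfter {E : List Row} (hE : IsSymbol E) (hP : Pprime E) (j : ℕ) (d : ℤ) :
    CompatAll (flagAfter j d E) := by
  intro p hp q hq
  obtain ⟨i, hi⟩ := List.mem_iff_getElem?.1 hp
  obtain ⟨k, hk⟩ := List.mem_iff_getElem?.1 hq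
  rw [flagAfter, List.getElem?_mapIdx, Option.map_eq_some_iff] at hi hk
  obtain ⟨r, hr, rfl⟩ := hi
  obtain ⟨s, hs, rfl⟩ := hk
  refine ⟨?_, fun h₁ h₂ => ?_⟩
  · simpa using hE.2.2.1 r (List.mem_of_getElem? hr) s (List.mem_of_getElem? hs)
  · have : i < k := by simp at h₁ h₂; omega
    simpa using hP.le_of_lt this hr hs

theorem Pprime.nonneg_of_shAfter {E : List Row} (hP : Pprime E) {j : ℕ} {x : ℚ}
    (h : ∀ r ∈ LocalArthur.shAfter j E, 0 ≤ r.B + x) : ∀ r ∈ E, 0 ≤ r.B + x := by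
  intro r hr
  cases E with
  | nil => simp at hr
  | cons s E =>
    have hs : s ∈ LocalArthur.shAfter j (s :: E) := by simp [LocalArthur.shAfter]
    have := h s hs
    rcases List.mem_cons.1 hr with rfl | hr
    · exact this
    · linarith [(List.pairwise_cons.1 hP).1 r hr]

/-- Lemma 4.2(i): shifting every row after the `j`-th one step to the right sends a
non-vanishing extended multi-segment datum whose order satisfies (P') to another one. -/
theorem shAfter_nonvanishing (E : List Row)
    (hE : IsEMS E) (hNV : NonVanishing E) (hP : Pprime E) (j : ℕ) :
    IsEMS (shAfter j E) ∧ NonVanishing (shAfter j E) ∧ Pprime (shAfter j E) := by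
  refine ⟨hE.shAfter hP j, ⟨hNV.1.shAfter j, fun d hd F hF => ?_⟩, hP.shAfter j⟩
  rw [← map_flagShift_flagAfter] at hF
  obtain ⟨M, hM, rfl, hEM⟩ := hF.exists_flagShift (compatAll_flagAfter hE.1 hP j d)
  rw [map_snd_flagAfter] at hEM
  exact (hNV.2 d (hP.nonneg_of_shAfter hd) _ hEM).map_flagShift hM

end LocalArthur
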